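/- Trap of type (b): let β > 0 and l ≥ 1, and consider the finite graph with vertices x₁, y, x₂, t₁, …, t_l and edges {x₁,y}, {y,x₂} (conductances 1 and β) and the path {y,t₁}, {t₁,t₂}, …, {t_{l−1},t_l} with conductances 1, β^{−1}, …, β^{1−l}. Let T_l be the number of steps the conductance-weighted random walk started at y takes strictly before its first visit to {x₁,x₂}. Then E[T_l] = (2β/(β+1))·(1 − β^{−l})/(β−1) if β ≠ 1, and E[T_l] = l if β = 1. -/

import Mathlib

open scoped BigOperators

/-- Conductances for a trap of type (b): vertices are `x₁ = Sum.inl 0`, `x₂ = Sum.inl 1`,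
`y = Sum.inr 0` and the trap vertices `tⱼ = Sum.inr j` (`1 ≤ j ≤ l`).  The edge `{x₁,y}`
has conductance `1`, the edge `{y,x₂}` has conductance `β`, and the path
`{y,t₁},…,{t_{l-1},t_l}` has conductances `1, β⁻¹, …, β^{1-l}`. -/
noncomputable def trapBCond (β : ℝ) (l : ℕ) :
    (Fin 2 ⊕ Fin (l + 1)) → (Fin 2 ⊕ Fin (l + 1)) → ℝ
  | Sum.inl i, Sum.inr j => if (j : ℕ) = 0 then (if i = 0 then 1 else β) else 0
  | Sum.inr j, Sum.inl i => if (j : ℕ) = 0 then (if i = 0 then 1 else β) else 0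
  | Sum.inr j, Sum.inr j' =>
      if (j : ℕ) + 1 = (j' : ℕ) ∨ (j' : ℕ) + 1 = (j : ℕ)
      then β ^ (-(min (j : ℕ) (j' : ℕ) : ℤ)) else 0
  | Sum.inl _, Sum.inl _ => 0

/-- The transition matrix of the conductance-weighted walk, killed upon hitting
`{x₁, x₂}`.  Thus `((trapBKilled β l) ^ n).mulVec 1 y = P_y[τ_{{x₁,x₂}} > n]`. -/
noncomputable def trapBKilled (β : ℝ) (l : ℕ) :
    Matrix (Fin 2 ⊕ Fin (l + 1)) (Fin 2 ⊕ Fin (l + 1)) ℝ := fun v w =>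
  if w = Sum.inl 0 ∨ w = Sum.inl 1 then 0
  else trapBCond β l v w / ∑ u, trapBCond β l v u

/-- The expected hitting time `E_y[τ_{{x₁,x₂}}] = Σ_{n≥0} P_y[τ > n]` of `{x₁,x₂}`
for the walk started at `y`. -/
noncomputable def trapBHit (β : ℝ) (l : ℕ) : ℝ :=
  ∑' n : ℕ, ((trapBKilled β l ^ n).mulVec (fun _ => (1 : ℝ))) (Sum.inr 0)

open Filter Topology Finset

/-- If `Q` has nonnegative entries and `h ≥ 1` solves `h = 1 + Q h`, then `h` is the Neumann series
of `Q` applied to the constant function `1`. -/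
theorem Matrix.hasSum_pow_mulVec_one {ι : Type*} [Fintype ι] [DecidableEq ι]
    (Q : Matrix ι ι ℝ) (hQ : ∀ v w, 0 ≤ Q v w) (h : ι → ℝ) (h1 : ∀ v, 1 ≤ h v)
    (heq : ∀ v, h v = 1 + Q.mulVec h v) (v : ι) :
    HasSum (fun n : ℕ => (Q ^ n).mulVec (fun _ => (1 : ℝ)) v) (h v) := by
  have hQn : ∀ n v w, 0 ≤ (Q ^ n) v w := by
    intro n
    induction n with
    | zero =>
      intro v w
      rw [pow_zero, Matrix.one_apply]
      split_ifs <;> norm_num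
    | succ n ih =>
      intro v w
      rw [pow_succ, Matrix.mul_apply]
      exact Finset.sum_nonneg fun u _ => mul_nonneg (ih v u) (hQ u w)
  have hmono : ∀ n (f g : ι → ℝ), (∀ v, f v ≤ g v) →
      ∀ v, (Q ^ n).mulVec f v ≤ (Q ^ n).mulVec g v := fun n f g hfg v =>
    Finset.sum_le_sum fun u _ => mul_le_mul_of_nonneg_left (hfg u) (hQn n v u)
  have hQh : Q.mulVec h = h - fun _ => (1 : ℝ) := by
    ext v
    have := heq v
    simp only [Pi.sub_apply]
    linarith
  have hpart : ∀ N, ∑ n ∈ range N, (Q ^ n).mulVec (fun _ => (1 : ℝ)) v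
      = h v - (Q ^ N).mulVec h v := by
    intro N
    induction N with
    | zero => simp
    | succ N ih =>
      rw [sum_range_succ, ih, pow_succ, ← Matrix.mulVec_mulVec, hQh, Matrix.mulVec_sub,
        Pi.sub_apply]
      ring
  set M : ℝ := ∑ u, h u with hM
  have hle : ∀ u, h u ≤ M := fun u =>
    Finset.single_le_sum (f := h) (fun w _ => zero_le_one.trans (h1 w)) (mem_univ u)
  have hM1 : 1 ≤ M := (h1 v).trans (hle v)
  have hM0 : 0 < M := by linarith
  have hr0 : 0 ≤ 1 - M⁻¹ := by
    have := inv_le_one_of_one_le₀ hM1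
    linarith
  have hr1 : 1 - M⁻¹ < 1 := by
    have := inv_pos.2 hM0
    linarith
  have hstep : ∀ u, Q.mulVec h u ≤ ((1 - M⁻¹) • h) u := by
    intro u
    have h2 : M⁻¹ * h u ≤ 1 := by
      rw [inv_mul_le_iff₀ hM0]
      linarith [hle u]
    rw [hQh]
    simp only [Pi.sub_apply, Pi.smul_apply, smul_eq_mul]
    linarith
  have hdecay : ∀ n, (Q ^ n).mulVec h v ≤ (1 - M⁻¹) ^ n * h v := by
    intro n
    induction n with
    | zero => simp
    | succ n ih =>
      rw [pow_succ, ← Matrix.mulVec_mulVec]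
      refine (hmono n _ _ hstep v).trans ?_
      rw [Matrix.mulVec_smul, Pi.smul_apply, smul_eq_mul, pow_succ]
      calc (1 - M⁻¹) * (Q ^ n).mulVec h v ≤ (1 - M⁻¹) * ((1 - M⁻¹) ^ n * h v) :=
            mul_le_mul_of_nonneg_left ih hr0
        _ = _ := by ring
  have hnonneg : ∀ n (f : ι → ℝ), (∀ u, 0 ≤ f u) → 0 ≤ (Q ^ n).mulVec f v := fun n f hf =>
    Finset.sum_nonneg fun u _ => mul_nonneg (hQn n v u) (hf u)
  have hlim : Tendsto (fun n : ℕ => (Q ^ n).mulVec h v) atTop (𝓝 0) := by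
    refine squeeze_zero (fun n => hnonneg n h fun u => zero_le_one.trans (h1 u)) hdecay ?_
    simpa using (tendsto_pow_atTop_nhds_zero_of_lt_one hr0 hr1).mul_const (h v)
  rw [hasSum_iff_tendsto_nat_of_nonneg fun n => hnonneg n _ fun _ => zero_le_one]
  simp_rw [hpart]
  simpa using hlim.const_sub (h v)

/-- Total conductance of the trap edges `{t_k, t_{k+1}}` with `j ≤ k < l` (where `t_0 = y`). -/
noncomputable def trapBTail (β : ℝ) (l j : ℕ) : ℝ := ∑ k ∈ Ico j l, (β ^ k)⁻¹

/-- The expected hitting time of `{x₁, x₂}` from the `j`-th vertex of the trap. -/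
noncomputable def trapBTime (β : ℝ) (l j : ℕ) : ℝ :=
  1 + 2 * trapBTail β l 0 / (1 + β)
    + ∑ i ∈ range j, β ^ i * (trapBTail β l i + trapBTail β l (i + 1))

/-- The expected first positive time at which `{x₁, x₂}` is visited. -/
noncomputable def trapBReturn (β : ℝ) (l : ℕ) : Fin 2 ⊕ Fin (l + 1) → ℝ
  | Sum.inl _ => 1 + trapBTime β l 0
  | Sum.inr j => trapBTime β l j

theorem trapBTail_nonneg {β : ℝ} (hβ : 0 < β) (l j : ℕ) : 0 ≤ trapBTail β l j :=
  Finset.sum_nonneg fun _ _ => by positivity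

theorem trapBTail_self (β : ℝ) (l : ℕ) : trapBTail β l l = 0 := by
  simp [trapBTail]

theorem trapBTail_of_lt (β : ℝ) {l j : ℕ} (hj : j < l) :
    trapBTail β l j = (β ^ j)⁻¹ + trapBTail β l (j + 1) :=
  Finset.sum_eq_sum_Ico_succ_bot hj _

theorem one_le_trapBTime {β : ℝ} (hβ : 0 < β) (l j : ℕ) : 1 ≤ trapBTime β l j := by
  have h0 := trapBTail_nonneg hβ l 0
  have h1 : 0 ≤ 2 * trapBTail β l 0 / (1 + β) := by positivity
  have h2 : 0 ≤ ∑ i ∈ range j, β ^ i * (trapBTail β l i + trapBTail β l (i + 1)) :=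
    Finset.sum_nonneg fun i _ => mul_nonneg (by positivity)
      (add_nonneg (trapBTail_nonneg hβ l i) (trapBTail_nonneg hβ l (i + 1)))
  unfold trapBTime
  linarith

theorem trapBTime_succ (β : ℝ) (l j : ℕ) :
    trapBTime β l (j + 1)
      = trapBTime β l j + β ^ j * (trapBTail β l j + trapBTail β l (j + 1)) := by
  simp only [trapBTime, sum_range_succ]
  ring

theorem trapBCond_nonneg {β : ℝ} (hβ : 0 < β) (l : ℕ) (v w : Fin 2 ⊕ Fin (l + 1)) :
    0 ≤ trapBCond β l v w := by
  rcases v with i | j <;> rcases w with i' | j' <;> simp only [trapBCond] <;>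
    (try split_ifs) <;> positivity

theorem trapBKilled_nonneg {β : ℝ} (hβ : 0 < β) (l : ℕ) (v w : Fin 2 ⊕ Fin (l + 1)) :
    0 ≤ trapBKilled β l v w := by
  unfold trapBKilled
  split_ifs
  · exact le_rfl
  · exact div_nonneg (trapBCond_nonneg hβ l v w)
      (Finset.sum_nonneg fun u _ => trapBCond_nonneg hβ l v u)

theorem trapBKilled_mulVec (β : ℝ) (l : ℕ) (f : Fin 2 ⊕ Fin (l + 1) → ℝ)
    (v : Fin 2 ⊕ Fin (l + 1)) :
    (trapBKilled β l).mulVec f v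
      = (∑ j, trapBCond β l v (Sum.inr j) * f (Sum.inr j)) / ∑ u, trapBCond β l v u := by
  simp only [Matrix.mulVec, dotProduct, Fintype.sum_sum_type, trapBKilled, Fin.sum_univ_two,
    Finset.sum_div]
  simp [div_mul_eq_mul_div]

/-- Summation over the trap neighbours of the `j`-th vertex of the trap. -/
theorem sum_trapBCond_inr (β : ℝ) (l : ℕ) (j : Fin (l + 1)) (f : ℕ → ℝ) :
    ∑ k : Fin (l + 1), trapBCond β l (Sum.inr j) (Sum.inr k) * f k
      = (if (j : ℕ) < l then (β ^ (j : ℕ))⁻¹ * f (j + 1) else 0)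
        + if 1 ≤ (j : ℕ) then (β ^ ((j : ℕ) - 1))⁻¹ * f (j - 1) else 0 := by
  obtain ⟨j, hj⟩ := j
  simp only [trapBCond]
  rw [Fin.sum_univ_eq_sum_range (fun k : ℕ =>
    (if j + 1 = k ∨ k + 1 = j then β ^ (-(min (j : ℤ) (k : ℤ))) else 0) * f k) (l + 1)]
  have hsplit : ∀ k : ℕ,
      (if j + 1 = k ∨ k + 1 = j then β ^ (-(min (j : ℤ) (k : ℤ))) else 0) * f k
        = (if k = j + 1 then (β ^ j)⁻¹ * f (j + 1) else 0)
          + if k = j - 1 then (if 1 ≤ j then (β ^ (j - 1))⁻¹ * f (j - 1) else 0) else 0 := by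
    intro k
    by_cases h1 : k = j + 1
    · subst h1
      have h2 : j + 1 ≠ j - 1 := by omega
      have h3 : min (j : ℤ) ((j + 1 : ℕ) : ℤ) = j := by omega
      rw [h3]
      simp [h2]
    · by_cases h2 : k + 1 = j
      · subst h2
        have h3 : min ((k + 1 : ℕ) : ℤ) (k : ℤ) = k := by omega
        have h4 : k ≠ k + 1 + 1 := by omega
        rw [h3]
        simp [h4]
      · have h3 : ¬ (j + 1 = k ∨ k + 1 = j) := by omega
        rw [if_neg h3, if_neg h1]
        split_ifs <;> first | omega | simp
  simp only [hsplit, sum_add_distrib, Finset.sum_ite_eq', mem_range]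
  have h4 : j - 1 < l + 1 := by omega
  simp [h4]

theorem trapBReturn_eq {β : ℝ} (hβ : 0 < β) {l : ℕ} (hl : 1 ≤ l) (v : Fin 2 ⊕ Fin (l + 1)) :
    trapBReturn β l v = 1 + (trapBKilled β l).mulVec (trapBReturn β l) v := by
  rw [trapBKilled_mulVec]
  rcases v with i | j
  · simp [trapBCond, trapBReturn]
    split_ifs <;> field_simp
  · have hsum := sum_trapBCond_inr β l j (trapBTime β l)
    have hone := sum_trapBCond_inr β l j (fun _ => 1)
    simp only [mul_one] at hone
    simp only [trapBReturn, Fintype.sum_sum_type, hsum, hone, Fin.sum_univ_two]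
    obtain ⟨j, hj⟩ := j
    simp only [trapBCond]
    rcases j with _ | j
    · have hl0 : 0 < l := hl
      have h1 := trapBTime_succ β l 0
      have h2 := trapBTail_of_lt β hl0
      simp only [zero_add, pow_zero, one_mul, inv_one] at h1 h2
      have h3 : trapBTime β l 0 = 1 + 2 * trapBTail β l 0 / (1 + β) := by simp [trapBTime]
      simp [hl0, h1]
      rw [h3, h2]
      field_simp
      ring
    · have h1 := trapBTime_succ β l j
      have h2 := trapBTail_of_lt β (show j < l by omega)
      by_cases hjl : j + 1 < l
      · have h3 := trapBTime_succ β l (j + 1)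
        have h4 := trapBTail_of_lt β hjl
        simp [hjl]
        rw [h3, h1, h2, h4]
        field_simp
        ring
      · obtain rfl : j + 1 = l := by omega
        simp
        rw [h1, h2, trapBTail_self]
        field_simp
        ring

theorem trapBHit_eq {β : ℝ} (hβ : 0 < β) {l : ℕ} (hl : 1 ≤ l) :
    trapBHit β l = 1 + 2 * (∑ k ∈ range l, (β⁻¹) ^ k) / (1 + β) := by
  have h1 : ∀ v, 1 ≤ trapBReturn β l v := by
    rintro (i | j)
    · have := one_le_trapBTime hβ l 0
      simp only [trapBReturn]
      linarith
    · exact one_le_trapBTime hβ l j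
  have h := Matrix.hasSum_pow_mulVec_one (trapBKilled β l) (trapBKilled_nonneg hβ l)
    (trapBReturn β l) h1 (trapBReturn_eq hβ hl) (Sum.inr 0)
  rw [trapBHit, h.tsum_eq]
  simp [trapBReturn, trapBTime, trapBTail]

/-- the expected time `E[T_l] = E_y[τ_{{x₁,x₂}}] - 1` spent in a trap of
type (b) with `l` edges equals `(2β/(β+1))·(1 - β^{-l})/(β-1)` for `β ≠ 1`,
and `l` for `β = 1`. -/
theorem expected_time_in_trap_type_b (β : ℝ) (hβ : 0 < β) (l : ℕ) (hl : 1 ≤ l) :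
    (β ≠ 1 → trapBHit β l - 1 = (2 * β / (β + 1)) * ((1 - (β ^ l)⁻¹) / (β - 1))) ∧
    (β = 1 → trapBHit β l - 1 = (l : ℝ)) := by
  rw [trapBHit_eq hβ hl]
  refine ⟨fun hne => ?_, ?_⟩
  · have h1 : β⁻¹ ≠ 1 := by simpa using hne
    have h2 : β - 1 ≠ 0 := sub_ne_zero.2 hne
    have h3 : β⁻¹ - 1 = -((β - 1) / β) := by
      field_simp
      ring
    rw [geom_sum_eq h1, h3, inv_pow]
    field_simp
    ring
  · rintro rfl
    norm_num
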